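/- Let φ : [0,1]^d → ℝ be a convex function with ∫_{[0,1]^d} |φ(x)|^p dx ≤ 1, where 1 ≤ p < ∞. Then there exists a constant c depending only on d and p such that for every y = (y₁,…,y_d) ∈ (0,1)^d, |φ(y)| ≤ c · ∏_{i=1}^d max(y_i^(-1/p), (1-y_i)^(-1/p)). -/

import Mathlib

open MeasureTheory Set

lemma aux_mid (d : ℕ) (φ : (Fin d → ℝ) → ℝ) (h : ConvexOn ℝ (Icc (0 : Fin d → ℝ) 1) φ)
    {x z : Fin d → ℝ} (hx : x ∈ Icc (0 : Fin d → ℝ) 1) (hz : z ∈ Icc (0 : Fin d → ℝ) 1) :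
    φ ((1/2 : ℝ) • x + (1/2 : ℝ) • z) ≤ (1/2 : ℝ) • φ x + (1/2 : ℝ) • φ z :=
  h.2 hx hz (by norm_num) (by norm_num) (by norm_num)

lemma aux_bdd (d : ℕ) (φ : (Fin d → ℝ) → ℝ) (h : ConvexOn ℝ (Icc (0 : Fin d → ℝ) 1) φ) :
    ∃ M : ℝ, ∀ x ∈ Icc (0 : Fin d → ℝ) 1, |φ x| ≤ M := by
  set V : Set (Fin d → ℝ) := Set.pi univ (fun _ => ({0, 1} : Set ℝ)) with hV
  have hfin : V.Finite := Set.Finite.pi (fun _ => Set.toFinite _)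
  have hull : convexHull ℝ V = Icc (0 : Fin d → ℝ) 1 := by
    rw [hV, convexHull_pi, ← Set.pi_univ_Icc]
    congr 1; ext i : 1
    rw [convexHull_pair, segment_eq_Icc (by norm_num)]; rfl
  obtain ⟨M, hM⟩ : ∃ M : ℝ, ∀ x ∈ Icc (0 : Fin d → ℝ) 1, φ x ≤ M := by
    obtain ⟨M, hM⟩ := (hfin.image φ).bddAbove
    refine ⟨M, fun x hx => ?_⟩
    rw [← hull] at h hx
    obtain ⟨v, hv, hle⟩ := h.exists_ge_of_mem_convexHull (subset_convexHull ℝ V) hx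
    exact hle.trans (hM ⟨v, hv, rfl⟩)
  refine ⟨max M (M - 2 * φ (fun _ => 1/2)), fun x hx => abs_le.2 ⟨?_, (hM x hx).trans (le_max_left _ _)⟩⟩
  have hx' : (1 - x) ∈ Icc (0 : Fin d → ℝ) 1 := by
    refine ⟨fun i => ?_, fun i => ?_⟩ <;> have := hx.1 i <;> have := hx.2 i <;> simp_all
  have h1 := aux_mid d φ h hx hx'
  have h2 : (1/2 : ℝ) • x + (1/2 : ℝ) • (1 - x) = fun _ => 1/2 := by
    ext i; simp; ring
  rw [h2] at h1
  have := hM _ hx'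
  have := le_max_right M (M - 2 * φ (fun _ => 1/2))
  simp only [smul_eq_mul] at h1
  linarith

lemma aux_int (d : ℕ) (p : ℝ) (hp : 1 ≤ p) (φ : (Fin d → ℝ) → ℝ)
    (h : ConvexOn ℝ (Icc (0 : Fin d → ℝ) 1) φ) :
    IntegrableOn (fun x => |φ x| ^ p) (Icc (0 : Fin d → ℝ) 1) := by
  obtain ⟨M, hM⟩ := aux_bdd d φ h
  have hae : interior (Icc (0 : Fin d → ℝ) 1) =ᵐ[volume] Icc (0 : Fin d → ℝ) 1 :=
    interior_ae_eq_of_null_frontier ((convex_Icc _ _).addHaar_frontier volume)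
  rw [← integrableOn_congr_set_ae hae]
  have hc : ContinuousOn (fun x => |φ x| ^ p) (interior (Icc (0 : Fin d → ℝ) 1)) :=
    (h.continuousOn_interior.abs).rpow_const (fun x _ => Or.inr (by linarith))
  refine IntegrableOn.of_bound (C := M ^ p) ?_ (hc.aestronglyMeasurable isOpen_interior.measurableSet) ?_
  · exact (measure_mono interior_subset).trans_lt isCompact_Icc.measure_lt_top
  · refine (ae_restrict_iff' isOpen_interior.measurableSet).2 (Filter.Eventually.of_forall fun x hx => ?_)
    rw [Real.norm_of_nonneg (by positivity)]
    exact Real.rpow_le_rpow (abs_nonneg _) (hM x (interior_subset hx)) (by linarith)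

lemma aux_mono (d : ℕ) (G : (Fin d → ℝ) → ℝ) (hG : Integrable G) (h0 : ∀ x, 0 ≤ G x)
    (a b : Fin d → ℝ) (hab : a ≤ b) (A : ℝ) (hA : ∀ x ∈ Icc a b, A ≤ G x) :
    A * ∏ i, (b i - a i) ≤ ∫ x, G x := by
  have h1 : ∫ x in Icc a b, A ≤ ∫ x in Icc a b, G x :=
    setIntegral_mono_on (by simp [integrableOn_const_iff, isCompact_Icc.measure_lt_top]) hG.integrableOn measurableSet_Icc hA
  have h2 := setIntegral_le_integral (s := Icc a b) hG (Filter.Eventually.of_forall h0)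
  rw [setIntegral_const, measureReal_def, Real.volume_Icc_pi_toReal hab] at h1
  simp only [smul_eq_mul] at h1
  linarith

lemma aux_max (p a b : ℝ) (ha : 0 ≤ a) (hb : 0 ≤ b) :
    (max a b) ^ p ≤ a ^ p + b ^ p := by
  have := Real.rpow_nonneg ha p
  have := Real.rpow_nonneg hb p
  rcases max_choice a b with h | h <;> rw [h] <;> linarith

/-- If `φ` is convex on the unit cube `[0,1]^d` with `∫ |φ|^p ≤ 1` where `1 ≤ p < ∞`,
then there is a constant `c` depending only on `d` and `p` such that for every interior
point `y`, `|φ y| ≤ c * ∏ i, max (y i ^ (-1/p)) ((1 - y i) ^ (-1/p))`. -/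
theorem stmt5 (d : ℕ) (hd : 1 ≤ d) (p : ℝ) (hp : 1 ≤ p) :
    ∃ c : ℝ, 0 < c ∧ ∀ φ : (Fin d → ℝ) → ℝ,
      ConvexOn ℝ (Icc (0 : Fin d → ℝ) 1) φ →
      (∫ x in Icc (0 : Fin d → ℝ) 1, |φ x| ^ p) ≤ 1 →
      ∀ y : Fin d → ℝ, (∀ i, y i ∈ Ioo (0:ℝ) 1) →
        |φ y| ≤ c * ∏ i, max ((y i) ^ (-(1/p))) ((1 - y i) ^ (-(1/p))) := by
  have hp0 : 0 < p := by linarith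
  refine ⟨3 * (1 + 2 ^ d) ^ (1 / p), by positivity, fun φ h hI y hy => ?_⟩
  set Q := Icc (0 : Fin d → ℝ) 1 with hQ
  set F : (Fin d → ℝ) → ℝ := Q.indicator (fun x => |φ x| ^ p) with hF
  have hFi : Integrable F := (aux_int d p hp φ h).integrable_indicator measurableSet_Icc
  have hF0 : ∀ x, 0 ≤ F x := fun x => indicator_nonneg (fun x _ => by positivity) x
  have hFQ : ∀ x ∈ Q, F x = |φ x| ^ p := fun x hx => indicator_of_mem hx _
  have hF1 : ∫ x, F x ≤ 1 := by rw [hF, integral_indicator measurableSet_Icc]; exact hI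
  have hyQ : y ∈ Q := ⟨fun i => (hy i).1.le, fun i => (hy i).2.le⟩
  set m : Fin d → ℝ := fun i => min (y i) (1 - y i) with hm
  have hm0 : ∀ i, 0 < m i := fun i => lt_min (hy i).1 (by linarith [(hy i).2])
  have hm1 : ∀ i, m i ≤ 1 := fun i => (min_le_left _ _).trans (hy i).2.le
  have hP0 : 0 < ∏ i, m i := Finset.prod_pos fun i _ => hm0 i
  have hP1 : ∏ i, m i ≤ 1 := Finset.prod_le_one (fun i _ => (hm0 i).le) fun i _ => hm1 i
  -- the key estimate
  have key : |φ y| ^ p * ∏ i, m i ≤ 3 ^ p * (1 + 2 ^ d) := by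
    rcases le_total 0 (φ y) with hs | hs
    · have hint : Integrable (fun x => F x + F ((2:ℝ) • y - x)) :=
        hFi.add (hFi.comp_sub_left _)
      have hmem : ∀ x ∈ Icc (y - m) (y + m), x ∈ Q := by
        intro x hx
        refine ⟨fun i => ?_, fun i => ?_⟩
        · have := hx.1 i; have := min_le_left (y i) (1 - y i)
          simp only [hm, Pi.sub_apply, Pi.zero_apply] at *; linarith
        · have := hx.2 i; have := min_le_right (y i) (1 - y i)
          simp only [hm, Pi.add_apply, Pi.one_apply] at *; linarith
      have := aux_mono d _ hint (fun x => add_nonneg (hF0 _) (hF0 _)) (y - m) (y + m)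
        (fun i => by have := hm0 i; simp only [Pi.sub_apply, Pi.add_apply]; linarith) (|φ y| ^ p) (by
          intro x hx
          have hx' : (2:ℝ) • y - x ∈ Icc (y - m) (y + m) := by
            refine ⟨fun i => ?_, fun i => ?_⟩ <;> have h1 := hx.1 i <;> have h2 := hx.2 i <;>
              simp only [Pi.sub_apply, Pi.add_apply, Pi.smul_apply, smul_eq_mul] at * <;> linarith
          rw [hFQ _ (hmem _ hx), hFQ _ (hmem _ hx')]
          refine le_trans ?_ (aux_max p _ _ (abs_nonneg _) (abs_nonneg _))
          refine Real.rpow_le_rpow (abs_nonneg _) ?_ hp0.le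
          have h1 := aux_mid d φ h (hmem _ hx) (hmem _ hx')
          have h2 : (1/2 : ℝ) • x + (1/2 : ℝ) • ((2:ℝ) • y - x) = y := by
            ext i; simp; ring
          rw [h2] at h1
          simp only [smul_eq_mul] at h1
          rw [abs_of_nonneg hs]
          have := le_max_left |φ x| |φ ((2:ℝ) • y - x)|
          have := le_max_right |φ x| |φ ((2:ℝ) • y - x)|
          have := le_abs_self (φ x)
          have := le_abs_self (φ ((2:ℝ) • y - x))
          linarith)
      rw [integral_add hFi (hFi.comp_sub_left _), integral_sub_left_eq_self F volume] at this
      have h3 : ∏ i, m i ≤ ∏ i, ((y + m) i - (y - m) i) :=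
        Finset.prod_le_prod (fun i _ => (hm0 i).le) fun i _ => by
          have := hm0 i; simp only [Pi.sub_apply, Pi.add_apply]; linarith
      have h4 : |φ y| ^ p * ∏ i, m i ≤ 2 := by
        have := mul_le_mul_of_nonneg_left h3 (Real.rpow_nonneg (abs_nonneg (φ y)) p)
        linarith
      have h5 : (1:ℝ) ≤ 3 ^ p := Real.one_le_rpow (by norm_num) hp0.le
      have h6 : (1:ℝ) ≤ 2 ^ d := one_le_pow₀ (by norm_num)
      nlinarith
    · have hint2 : Integrable (fun x => F ((1/2 : ℝ) • x + (1/2 : ℝ) • y)) :=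
        (hFi.comp_add_right ((1/2 : ℝ) • y)).comp_smul (by norm_num)
      have hint := (hFi.add hint2).const_mul (3 ^ p)
      have := aux_mono d _ hint (fun x => mul_nonneg (by positivity) (add_nonneg (hF0 _) (hF0 _))) 0 1
        (zero_le_one) (|φ y| ^ p) (by
          intro x hx
          have hx' : (1/2 : ℝ) • x + (1/2 : ℝ) • y ∈ Q :=
            h.1 hx hyQ (by norm_num) (by norm_num) (by norm_num)
          simp only [Pi.add_apply]
          rw [hFQ _ hx, hFQ _ hx']
          refine le_trans ?_ (mul_le_mul_of_nonneg_left (aux_max p _ _ (abs_nonneg _) (abs_nonneg _)) (by positivity))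
          rw [← Real.mul_rpow (by norm_num) (by positivity)]
          refine Real.rpow_le_rpow (abs_nonneg _) ?_ hp0.le
          have h1 := aux_mid d φ h hx hyQ
          simp only [smul_eq_mul] at h1
          rw [abs_of_nonpos hs]
          set w := (1/2 : ℝ) • x + (1/2 : ℝ) • y
          have := le_max_left |φ x| |φ w|
          have := le_max_right |φ x| |φ w|
          have := le_abs_self (φ x)
          have := neg_abs_le (φ w)
          linarith)
      have e1 : ∫ x, F ((1/2 : ℝ) • x + (1/2 : ℝ) • y) = 2 ^ d * ∫ x, F x := by
        rw [Measure.integral_comp_smul volume (fun z => F (z + (1/2 : ℝ) • y)) (1/2 : ℝ),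
          integral_add_right_eq_self F]
        simp
      rw [integral_const_mul] at this
      simp only [Pi.add_apply] at this
      rw [integral_add hFi hint2, e1] at this
      simp only [Pi.one_apply, Pi.zero_apply, sub_zero, Finset.prod_const_one, mul_one] at this
      have h7 : |φ y| ^ p * ∏ i, m i ≤ |φ y| ^ p :=
        mul_le_of_le_one_right (by positivity) hP1
      refine h7.trans (this.trans ?_)
      have : (2:ℝ) ^ d * ∫ x, F x ≤ 2 ^ d := mul_le_of_le_one_right (by positivity) hF1
      gcongr
  have k2 : |φ y| ^ p ≤ 3 ^ p * (1 + 2 ^ d) * (∏ i, m i)⁻¹ := by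
    rw [← div_eq_mul_inv, le_div_iff₀ hP0]; exact key
  have k3 : |φ y| ≤ 3 * (1 + 2 ^ d) ^ (1 / p) * (∏ i, m i) ^ (-(1 / p)) := by
    have := Real.rpow_le_rpow (by positivity) k2 (z := 1 / p) (by positivity)
    rw [Real.mul_rpow (by positivity) (by positivity), Real.mul_rpow (by positivity) (by positivity),
      ← Real.rpow_mul (by positivity), ← Real.rpow_mul (by positivity), mul_one_div_cancel hp0.ne',
      Real.rpow_one, Real.rpow_one, Real.inv_rpow hP0.le, ← Real.rpow_neg hP0.le] at this
    exact this
  refine k3.trans (mul_le_mul_of_nonneg_left ?_ (by positivity))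
  rw [← Real.finsetProd_rpow _ _ (fun i _ => (hm0 i).le)]
  refine Finset.prod_le_prod (fun i _ => Real.rpow_nonneg (hm0 i).le _) fun i _ => ?_
  rcases min_choice (y i) (1 - y i) with e | e
  · simp only [hm, e]; exact le_max_left _ _
  · simp only [hm, e]; exact le_max_right _ _
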